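/- Let ν > 0 be real and t > 0. For every smooth function φ: ℝ → ℂ with compact support contained in (0, ∞), both of the following series converge absolutely and ∑_{m=0}^∞ (m!/(ν)_m) · e^{−t} L_m^{ν−1}(2t) · (2/Γ(ν)) ∫_0^∞ u·φ(u) · e^{−u} L_m^{ν−1}(2u) · (2u)^{ν−1} du = t · ∑_{m=0}^∞ (m!/(ν)_m) · e^{−t} L_m^{ν−1}(2t) · (2/Γ(ν)) ∫_0^∞ φ(u) · e^{−u} L_m^{ν−1}(2u) · (2u)^{ν−1} du. -/

import Mathlib

open MeasureTheory

/-- The generalized Laguerre polynomial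
`L_n^α(x) = ∑_{k=0}^n ((−1)^k / k!) ((α+k+1)_{n−k} / (n−k)!) x^k`. -/
noncomputable def laguerreL (α : ℝ) (n : ℕ) (x : ℝ) : ℝ :=
  ∑ k ∈ Finset.range (n + 1),
    ((-1 : ℝ) ^ k / (Nat.factorial k)) *
      ((ascPochhammer ℝ (n - k)).eval (α + (k : ℝ) + 1) / (Nat.factorial (n - k))) * x ^ k

open Polynomial in
/-- The Laguerre polynomial `laguerreL α n` as an element of `ℝ[X]`. -/
noncomputable def laguerrePoly (α : ℝ) (n : ℕ) : ℝ[X] :=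
  ∑ k ∈ Finset.range (n + 1), monomial k
    (((-1 : ℝ) ^ k / (Nat.factorial k)) *
      ((ascPochhammer ℝ (n - k)).eval (α + (k : ℝ) + 1) / (Nat.factorial (n - k))))

namespace laguerrePoly

open Polynomial

lemma eval_eq (α : ℝ) (n : ℕ) (x : ℝ) : (laguerrePoly α n).eval x = laguerreL α n x := by
  simp [laguerrePoly, laguerreL, eval_finsetSum]

lemma ascPochhammer_eval_succ_left (b : ℝ) (j : ℕ) :
    (ascPochhammer ℝ (j + 1)).eval b = b * (ascPochhammer ℝ j).eval (b + 1) := by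
  simp [ascPochhammer_succ_left]

lemma coeff_of_lt {α : ℝ} {n k : ℕ} (h : n < k) : (laguerrePoly α n).coeff k = 0 := by
  rw [laguerrePoly, finsetSum_coeff]
  refine Finset.sum_eq_zero fun i hi => ?_
  rw [coeff_monomial, if_neg]
  have := Finset.mem_range.1 hi
  omega

lemma coeff_add (α : ℝ) (j k : ℕ) : (laguerrePoly α (j + k)).coeff k =
    ((-1 : ℝ) ^ k / (Nat.factorial k)) *
      ((ascPochhammer ℝ j).eval (α + (k : ℝ) + 1) / (Nat.factorial j)) := by
  simp only [laguerrePoly, finsetSum_coeff, coeff_monomial]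
  rw [Finset.sum_eq_single k]
  · simp
  · intro b _ hb
    simp [hb]
  · intro h
    exact absurd (Finset.mem_range.2 (by omega)) h

/-- Consecutive coefficients. -/
lemma coeff_succ_mul (α : ℝ) (n k : ℕ) :
    ((k : ℝ) + 1) * (α + k + 1) * (laguerrePoly α n).coeff (k + 1) +
      ((n : ℝ) - k) * (laguerrePoly α n).coeff k = 0 := by
  rcases lt_trichotomy n k with h | rfl | h
  · rw [coeff_of_lt h, coeff_of_lt (by omega : n < k + 1)]; ring
  · rw [coeff_of_lt (Nat.lt_succ_self n)]; ring
  · obtain ⟨j, rfl⟩ : ∃ j, n = j + (k + 1) := ⟨n - (k + 1), by omega⟩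
    rw [coeff_add, show j + (k + 1) = (j + 1) + k by ring, coeff_add,
      ascPochhammer_eval_succ_left]
    have e : α + ((k + 1 : ℕ) : ℝ) + 1 = α + k + 1 + 1 := by push_cast; ring
    rw [e, Nat.factorial_succ k, Nat.factorial_succ j]
    push_cast
    have h1 : ((Nat.factorial k : ℕ) : ℝ) ≠ 0 := by positivity
    have h2 : ((Nat.factorial j : ℕ) : ℝ) ≠ 0 := by positivity
    field_simp
    ring

lemma ode (α : ℝ) (n : ℕ) :
    X * derivative (derivative (laguerrePoly α n)) +
      (C (α + 1) - X) * derivative (laguerrePoly α n) + C (n : ℝ) * laguerrePoly α n = 0 := by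
  ext k
  have h := coeff_succ_mul α n k
  simp only [sub_mul, Polynomial.coeff_add, coeff_sub, coeff_C_mul, coeff_zero]
  rcases k with _ | k
  · simp only [coeff_X_mul_zero, coeff_derivative]
    push_cast at h ⊢
    linear_combination h
  · simp only [coeff_X_mul, coeff_derivative]
    push_cast at h ⊢
    linear_combination h

lemma eq_sub (α : ℝ) (n : ℕ) :
    laguerrePoly α (n + 1) = laguerrePoly (α + 1) (n + 1) - laguerrePoly (α + 1) n := by
  ext k
  rw [coeff_sub]
  rcases lt_trichotomy k (n + 1) with h | rfl | h
  · obtain ⟨j, rfl⟩ : ∃ j, n = j + k := ⟨n - k, by omega⟩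
    rw [show j + k + 1 = (j + 1) + k by ring, coeff_add, coeff_add, coeff_add,
      ascPochhammer_eval_succ_left, ascPochhammer_succ_eval]
    have e : α + 1 + (k : ℝ) + 1 = α + k + 1 + 1 := by ring
    rw [e, Nat.factorial_succ j]
    push_cast
    have h2 : ((Nat.factorial j : ℕ) : ℝ) ≠ 0 := by positivity
    field_simp
    ring
  · have h0 := fun α => coeff_add α 0 (n + 1)
    rw [zero_add] at h0
    rw [h0, h0, coeff_of_lt (Nat.lt_succ_self n)]
    simp
  · rw [coeff_of_lt h, coeff_of_lt h, coeff_of_lt (by omega : n < k)]; simp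

lemma zero (α : ℝ) : laguerrePoly α 0 = 1 := by simp [laguerrePoly]

lemma one (α : ℝ) : laguerrePoly α 1 = C (α + 1) - X := by
  simp [laguerrePoly, Finset.sum_range_succ, ← C_mul_X_pow_eq_monomial]
  ring

/-- The three-term recurrence. -/
lemma three_term (α : ℝ) (n : ℕ) :
    X * laguerrePoly α (n + 1) = C (2 * (n : ℝ) + α + 3) * laguerrePoly α (n + 1) -
      C ((n : ℝ) + 2) * laguerrePoly α (n + 2) - C ((n : ℝ) + 1 + α) * laguerrePoly α n := by
  ext k
  simp only [coeff_sub, coeff_C_mul]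
  have hlast : ∀ m, (laguerrePoly α m).coeff m = (-1) ^ m / (Nat.factorial m : ℝ) := fun m => by
    simpa using coeff_add α 0 m
  have hpen : ∀ m, (laguerrePoly α (m + 1)).coeff m =
      (-1) ^ m / (Nat.factorial m : ℝ) * (α + m + 1) := fun m => by
    simpa [add_comm] using coeff_add α 1 m
  rcases k with _ | k
  · have h0 := fun m => coeff_add α m 0
    simp only [add_zero] at h0
    rw [coeff_X_mul_zero, h0, h0, h0, show n + 2 = n + 1 + 1 by ring,
      ascPochhammer_succ_eval (n + 1), ascPochhammer_succ_eval n, Nat.factorial_succ (n + 1),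
      Nat.factorial_succ n]
    push_cast
    have h2 : ((Nat.factorial n : ℕ) : ℝ) ≠ 0 := by positivity
    field_simp
    ring
  · rw [coeff_X_mul]
    rcases lt_or_ge k n with h | h
    · obtain ⟨j, rfl⟩ : ∃ j, n = j + (k + 1) := ⟨n - (k + 1), by omega⟩
      rw [coeff_add, show j + (k + 1) + 2 = (j + 2) + (k + 1) by ring, coeff_add,
        show j + (k + 1) + 1 = (j + 1) + (k + 1) by ring, coeff_add,
        show j + 1 + (k + 1) = (j + 2) + k by ring, coeff_add]
      rw [show j + 2 = j + 1 + 1 by ring, ascPochhammer_eval_succ_left (α + k + 1)]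
      have e : α + ((k + 1 : ℕ) : ℝ) + 1 = α + k + 1 + 1 := by push_cast; ring
      rw [e]
      simp only [ascPochhammer_succ_eval, Nat.factorial_succ]
      push_cast
      have h1 : ((Nat.factorial k : ℕ) : ℝ) ≠ 0 := by positivity
      have h2 : ((Nat.factorial j : ℕ) : ℝ) ≠ 0 := by positivity
      field_simp
      ring
    · rw [coeff_of_lt (by omega : n < k + 1)]
      rcases lt_trichotomy k (n + 1) with h' | rfl | h'
      · obtain rfl : k = n := by omega
        rw [hpen, hlast, show k + 2 = k + 1 + 1 by ring, hpen, Nat.factorial_succ]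
        push_cast
        field_simp
        ring
      · rw [coeff_of_lt (by omega : n + 1 < n + 1 + 1), hlast, hlast, Nat.factorial_succ (n + 1)]
        push_cast
        field_simp
        ring
      · rw [coeff_of_lt h', coeff_of_lt (by omega : n + 1 < k + 1),
          coeff_of_lt (by omega : n + 2 < k + 1)]
        ring

/-- Monotonicity of `exp (-2x) (n y² + x y'²)` for `y = L_n^α` with `α ≥ -1/2`. -/
lemma abs_eval_le {α : ℝ} (hα : -(1 / 2) ≤ α) (n : ℕ) {x : ℝ} (hx : 0 ≤ x) :
    |(laguerrePoly α n).eval x| ≤ Real.exp x * |(laguerrePoly α n).eval 0| := by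
  rcases Nat.eq_zero_or_pos n with rfl | hn
  · simp [zero, hx]
  set P := laguerrePoly α n with hP
  have hn' : (0 : ℝ) < n := by exact_mod_cast hn
  have hode : ∀ s : ℝ, s * (derivative (derivative P)).eval s +
      (α + 1 - s) * (derivative P).eval s + n * P.eval s = 0 := fun s => by
    simpa using congrArg (eval s) (ode α n)
  let E : ℝ → ℝ := fun s =>
    Real.exp (-2 * s) * (n * P.eval s ^ 2 + s * (derivative P).eval s ^ 2)
  have hE : ∀ s, HasDerivAt E (Real.exp (-2 * s) *
      (-(2 * α + 1) * (derivative P).eval s ^ 2 - 2 * n * P.eval s ^ 2)) s := fun s => by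
    have h1 : HasDerivAt (fun s : ℝ => Real.exp (-2 * s)) (Real.exp (-2 * s) * (-2)) s := by
      simpa using ((hasDerivAt_id s).const_mul (-2)).exp
    have h2 := ((P.hasDerivAt s).pow 2).const_mul (n : ℝ)
    have h3 := (hasDerivAt_id s).mul (((derivative P).hasDerivAt s).pow 2)
    refine (h1.mul (h2.add h3)).congr_deriv ?_
    simp
    linear_combination Real.exp (-(2 * s)) * 2 * (derivative P).eval s * hode s
  have hanti : AntitoneOn E (Set.Ici 0) := by
    refine (antitone_of_hasDerivAt_nonpos hE fun s => ?_).antitoneOn _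
    refine mul_nonpos_of_nonneg_of_nonpos (Real.exp_nonneg _) ?_
    nlinarith [mul_nonneg (by linarith : (0 : ℝ) ≤ 2 * α + 1) (sq_nonneg ((derivative P).eval s)),
      mul_nonneg hn'.le (sq_nonneg (P.eval s))]
  have h := hanti (Set.mem_Ici.2 le_rfl) (Set.mem_Ici.2 hx) hx
  have h' : Real.exp (-2 * x) * P.eval x ^ 2 ≤ P.eval 0 ^ 2 := by
    have hx' : 0 ≤ Real.exp (-2 * x) * (x * (derivative P).eval x ^ 2) := by positivity
    simp only [E, mul_zero, Real.exp_zero, one_mul, zero_mul, add_zero] at h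
    refine le_of_mul_le_mul_left ?_ hn'
    linarith
  have h'' : P.eval x ^ 2 ≤ (Real.exp x * P.eval 0) ^ 2 := by
    have e : Real.exp x ^ 2 * Real.exp (-2 * x) = 1 := by
      rw [← Real.exp_nat_mul, ← Real.exp_add]; simp
    calc P.eval x ^ 2 = Real.exp x ^ 2 * (Real.exp (-2 * x) * P.eval x ^ 2) := by
          rw [← mul_assoc, e, one_mul]
      _ ≤ Real.exp x ^ 2 * P.eval 0 ^ 2 := by gcongr
      _ = _ := by ring
  simpa [abs_mul] using sq_le_sq.1 h''

lemma eval_zero_eq (α : ℝ) (n : ℕ) :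
    (laguerrePoly α n).eval 0 = (ascPochhammer ℝ n).eval (α + 1) / (Nat.factorial n) := by
  simpa [coeff_zero_eq_eval_zero] using coeff_add α n 0

lemma eval_zero_succ (α : ℝ) (n : ℕ) :
    (laguerrePoly α (n + 1)).eval 0 = (1 + α / (n + 1)) * (laguerrePoly α n).eval 0 := by
  rw [eval_zero_eq, eval_zero_eq, ascPochhammer_succ_eval, Nat.factorial_succ]
  push_cast
  field_simp
  ring

lemma eval_zero_pos {α : ℝ} (hα : 0 ≤ α) (n : ℕ) : 0 < (laguerrePoly α n).eval 0 := by
  rw [eval_zero_eq]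
  have := ascPochhammer_pos n (α + 1) (by linarith)
  positivity

lemma eval_zero_le_succ {α : ℝ} (hα : 0 ≤ α) (n : ℕ) :
    (laguerrePoly α n).eval 0 ≤ (laguerrePoly α (n + 1)).eval 0 := by
  rw [eval_zero_succ]
  have : 0 ≤ α / (n + 1) := by positivity
  exact le_mul_of_one_le_left (eval_zero_pos hα n).le (by linarith)

lemma eval_zero_le_pow {α : ℝ} (hα : 0 ≤ α) {N : ℕ} (hN : α ≤ N) (n : ℕ) :
    (laguerrePoly α n).eval 0 ≤ ((n : ℝ) + 1) ^ N := by
  induction n with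
  | zero => simp [zero]
  | succ n ih =>
    rw [eval_zero_succ]
    have h1 : 1 + α / ((n : ℝ) + 1) ≤ (1 + 1 / ((n : ℝ) + 1)) ^ N := by
      have hb := one_add_mul_le_pow (a := 1 / ((n : ℝ) + 1))
        (by have : 0 ≤ 1 / ((n : ℝ) + 1) := by positivity
            linarith) N
      refine le_trans ?_ hb
      rw [mul_one_div]
      gcongr
    calc _ ≤ (1 + 1 / ((n : ℝ) + 1)) ^ N * ((n : ℝ) + 1) ^ N :=
          mul_le_mul h1 ih (eval_zero_pos hα n).le (by positivity)
      _ = _ := by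
        rw [← mul_pow]
        congr 1
        push_cast
        field_simp

/-- A bound on Laguerre polynomials valid for all `α > -1`. -/
lemma abs_eval_sub_one_le {ν : ℝ} (hν : 0 ≤ ν) (n : ℕ) {x : ℝ} (hx : 0 ≤ x) :
    |(laguerrePoly (ν - 1) n).eval x| ≤ 2 * Real.exp x * (laguerrePoly ν n).eval 0 := by
  have hb : ∀ n, |(laguerrePoly ν n).eval x| ≤ Real.exp x * (laguerrePoly ν n).eval 0 :=
    fun n => by
      simpa [abs_of_pos (eval_zero_pos hν n)] using abs_eval_le (α := ν) (by linarith) n hx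
  rcases n with _ | n
  · simp only [zero, eval_one, abs_one, mul_one]
    linarith [Real.add_one_le_exp x]
  · have h := eq_sub (ν - 1) n
    rw [sub_add_cancel] at h
    rw [h, eval_sub]
    have h1 := hb n
    have h2 := hb (n + 1)
    have h3 := mul_le_mul_of_nonneg_left (eval_zero_le_succ hν n) (Real.exp_nonneg x)
    linarith [abs_sub (eval x (laguerrePoly ν (n + 1))) (eval x (laguerrePoly ν n))]

end laguerrePoly

namespace laguerreFunction

open Polynomial laguerrePoly
open scoped ContDiff

/-- `e^{-u} L_m^{ν-1}(2u) (2u)^{ν-1}`, the Laguerre function times its weight. -/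
noncomputable def weighted (ν : ℝ) (m : ℕ) (u : ℝ) : ℝ :=
  Real.exp (-u) * laguerreL (ν - 1) m (2 * u) * (2 * u) ^ (ν - 1)

/-- The pairing of `φ` with a Laguerre function. -/
noncomputable def pairing (ν : ℝ) (m : ℕ) (φ : ℝ → ℂ) : ℂ :=
  ∫ u in Set.Ioi (0 : ℝ), φ u * (weighted ν m u : ℂ)

/-- The operator with `ℓ_m` as eigenfunction of eigenvalue `2m + ν`, transposed. -/
noncomputable def transposedOp (ν : ℝ) (φ : ℝ → ℂ) (u : ℝ) : ℂ :=
  u * φ u - u * deriv (deriv φ) u - ν * deriv φ u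

/-- Smooth functions supported in `(a, b)`. -/
structure IsTest (a b : ℝ) (φ : ℝ → ℂ) : Prop where
  contDiff : ContDiff ℝ ∞ φ
  tsupport_subset : tsupport φ ⊆ Set.Ioo a b

variable {ν a b : ℝ} {φ : ℝ → ℂ}

lemma IsTest.eq_zero (h : IsTest a b φ) {u : ℝ} (hu : u ∉ Set.Ioo a b) : φ u = 0 :=
  image_eq_zero_of_notMem_tsupport fun h' => hu (h.tsupport_subset h')

lemma IsTest.deriv (h : IsTest a b φ) : IsTest a b (deriv φ) :=
  ⟨(contDiff_infty_iff_deriv.1 h.contDiff).2,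
    (closure_minimal support_deriv_subset (isClosed_tsupport φ)).trans h.tsupport_subset⟩

lemma IsTest.mul_left (h : IsTest a b φ) {g : ℝ → ℂ} (hg : ContDiff ℝ ∞ g) :
    IsTest a b (fun u => g u * φ u) :=
  ⟨hg.mul h.contDiff, tsupport_mul_subset_right.trans h.tsupport_subset⟩

lemma IsTest.sub {ψ : ℝ → ℂ} (h : IsTest a b φ) (h' : IsTest a b ψ) :
    IsTest a b (fun u => φ u - ψ u) :=
  ⟨h.contDiff.sub h'.contDiff, (tsupport_sub φ ψ).trans
    (Set.union_subset h.tsupport_subset h'.tsupport_subset)⟩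

lemma IsTest.id_mul (h : IsTest a b φ) : IsTest a b (fun u => (u : ℂ) * φ u) :=
  h.mul_left Complex.ofRealCLM.contDiff

lemma IsTest.transposedOp (h : IsTest a b φ) : IsTest a b (transposedOp ν φ) :=
  (h.id_mul.sub h.deriv.deriv.id_mul).sub (h.deriv.mul_left contDiff_const)

lemma exists_isTest (hφ : ContDiff ℝ ∞ φ) (hcs : HasCompactSupport φ)
    (hsupp : tsupport φ ⊆ Set.Ioi 0) : ∃ a b, 0 < a ∧ a ≤ b ∧ IsTest a b φ := by
  rcases (tsupport φ).eq_empty_or_nonempty with he | hne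
  · exact ⟨1, 1, one_pos, le_rfl, hφ, by simp [he]⟩
  · obtain ⟨x, hx, hmin⟩ := hcs.isCompact.exists_isLeast hne
    obtain ⟨y, hy, hmax⟩ := hcs.isCompact.exists_isGreatest hne
    have hx0 : 0 < x := hsupp hx
    have hxy : x ≤ y := hmin hy
    refine ⟨x / 2, y + 1, by linarith, by linarith, hφ, fun z hz => ⟨?_, ?_⟩⟩
    · linarith [hmin hz]
    · linarith [hmax hz]

lemma continuousOn_rpow (ν : ℝ) (ha : 0 < a) :
    ContinuousOn (fun u : ℝ => (2 * u) ^ (ν - 1)) (Set.Icc a b) := by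
  refine ContinuousOn.rpow_const (by fun_prop) fun u hu => Or.inl ?_
  have := ha.trans_le hu.1
  positivity

lemma continuousOn_weighted (ν : ℝ) (m : ℕ) (ha : 0 < a) :
    ContinuousOn (weighted ν m) (Set.Icc a b) := by
  unfold weighted
  simp only [← laguerrePoly.eval_eq]
  exact (by fun_prop : ContinuousOn (fun u : ℝ =>
    Real.exp (-u) * (laguerrePoly (ν - 1) m).eval (2 * u)) _).mul (continuousOn_rpow ν ha)

lemma intervalIntegrable (h : IsTest a b φ) (m : ℕ) (ha : 0 < a) (hab : a ≤ b) :
    IntervalIntegrable (fun u => φ u * (weighted ν m u : ℂ)) volume a b := by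
  refine ContinuousOn.intervalIntegrable_of_Icc hab ?_
  exact h.contDiff.continuous.continuousOn.mul
    (Complex.continuous_ofReal.comp_continuousOn (continuousOn_weighted ν m ha))

lemma pairing_eq (h : IsTest a b φ) (m : ℕ) (ha : 0 < a) (hab : a ≤ b) :
    pairing ν m φ = ∫ u in a..b, φ u * (weighted ν m u : ℂ) := by
  rw [intervalIntegral.integral_of_le hab, pairing]
  refine setIntegral_eq_of_subset_of_forall_sdiff_eq_zero measurableSet_Ioi
    (fun u hu => ha.trans hu.1) fun u hu => ?_
  rw [h.eq_zero fun h' => hu.2 ⟨h'.1, h'.2.le⟩, zero_mul]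

lemma two_mul_weighted_zero (ν u : ℝ) :
    2 * (u * weighted ν 0 u) = ν * weighted ν 0 u - weighted ν 1 u := by
  simp only [weighted, ← laguerrePoly.eval_eq, laguerrePoly.zero, laguerrePoly.one]
  simp
  ring

lemma two_mul_weighted_succ (ν : ℝ) (n : ℕ) (u : ℝ) :
    2 * (u * weighted ν (n + 1) u) = (2 * n + 2 + ν) * weighted ν (n + 1) u -
      (n + 2) * weighted ν (n + 2) u - (n + ν) * weighted ν n u := by
  have h := congrArg (eval (2 * u)) (three_term (ν - 1) n)
  simp only [eval_mul, eval_sub, eval_X, eval_C] at h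
  simp only [weighted, ← laguerrePoly.eval_eq]
  linear_combination Real.exp (-u) * (2 * u) ^ (ν - 1) * h

lemma two_mul_pairing_zero (h : IsTest a b φ) (ha : 0 < a) (hab : a ≤ b) :
    2 * pairing ν 0 (fun u => u * φ u) = ν * pairing ν 0 φ - pairing ν 1 φ := by
  rw [pairing_eq h.id_mul 0 ha hab, pairing_eq h 0 ha hab, pairing_eq h 1 ha hab,
    ← intervalIntegral.integral_const_mul, ← intervalIntegral.integral_const_mul,
    ← intervalIntegral.integral_sub ((intervalIntegrable h 0 ha hab).const_mul _)
      (intervalIntegrable h 1 ha hab)]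
  refine intervalIntegral.integral_congr fun u _ => ?_
  have e := congrArg (fun x : ℝ => (x : ℂ)) (two_mul_weighted_zero ν u)
  push_cast at e
  linear_combination φ u * e

lemma two_mul_pairing_succ (h : IsTest a b φ) (ha : 0 < a) (hab : a ≤ b) (n : ℕ) :
    2 * pairing ν (n + 1) (fun u => u * φ u) = (2 * n + 2 + ν) * pairing ν (n + 1) φ -
      (n + 2) * pairing ν (n + 2) φ - (n + ν) * pairing ν n φ := by
  have hi := fun m (c : ℂ) => (intervalIntegrable (ν := ν) h m ha hab).const_mul c
  rw [pairing_eq h.id_mul _ ha hab, pairing_eq h _ ha hab, pairing_eq h _ ha hab,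
    pairing_eq h _ ha hab, ← intervalIntegral.integral_const_mul,
    ← intervalIntegral.integral_const_mul, ← intervalIntegral.integral_const_mul,
    ← intervalIntegral.integral_const_mul, ← intervalIntegral.integral_sub (hi _ _) (hi _ _),
    ← intervalIntegral.integral_sub ((hi _ _).sub (hi _ _)) (hi _ _)]
  refine intervalIntegral.integral_congr fun u _ => ?_
  have e := congrArg (fun x : ℝ => (x : ℂ)) (two_mul_weighted_succ ν n u)
  push_cast at e
  linear_combination φ u * e

/-- The Laguerre function is an eigenfunction; integrate by parts twice. -/
lemma pairing_transposedOp (h : IsTest a b φ) (ha : 0 < a) (hab : a ≤ b) (m : ℕ) :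
    pairing ν m (transposedOp ν φ) = (2 * m + ν) * pairing ν m φ := by
  set P := laguerrePoly (ν - 1) m with hP
  let f : ℝ → ℝ := fun u => Real.exp (-u) * P.eval (2 * u)
  let g : ℝ → ℝ := fun u => Real.exp (-u) *
    (2 * (derivative P).eval (2 * u) - P.eval (2 * u))
  let q : ℝ → ℝ := fun u => u * (2 * u) ^ (ν - 1)
  have hexp : ∀ u : ℝ, HasDerivAt (fun u : ℝ => Real.exp (-u)) (-Real.exp (-u)) u := fun u => by
    simpa using (hasDerivAt_neg u).exp
  have heval : ∀ (Q : ℝ[X]) (u : ℝ),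
      HasDerivAt (fun u : ℝ => Q.eval (2 * u)) (2 * (derivative Q).eval (2 * u)) u := fun Q u => by
    have h2 : HasDerivAt (fun u : ℝ => 2 * u) 2 u := by
      simpa using (hasDerivAt_id u).const_mul (2 : ℝ)
    simpa [mul_comm, Function.comp_def] using (Q.hasDerivAt (2 * u)).comp u h2
  have hf : ∀ u, HasDerivAt f (g u) u := fun u => by
    refine ((hexp u).mul (heval P u)).congr_deriv ?_
    simp only [g]
    ring
  have hg : ∀ u, HasDerivAt g (Real.exp (-u) * (4 * (derivative (derivative P)).eval (2 * u) -
      4 * (derivative P).eval (2 * u) + P.eval (2 * u))) u := fun u => by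
    refine ((hexp u).mul (((heval (derivative P) u).const_mul 2).sub (heval P u))).congr_deriv ?_
    simp only [Pi.sub_apply]
    ring
  have hq : ∀ u, 0 < u → HasDerivAt q (ν * (2 * u) ^ (ν - 1)) u := fun u hu => by
    have h2 : HasDerivAt (fun u : ℝ => 2 * u) 2 u := by
      simpa using (hasDerivAt_id u).const_mul (2 : ℝ)
    refine ((hasDerivAt_id u).mul
      (h2.rpow_const (p := ν - 1) (Or.inl (by positivity)))).congr_deriv ?_
    have e : (2 * u) ^ (ν - 1) = (2 * u) ^ (ν - 1 - 1) * (2 * u) := by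
      rw [← Real.rpow_add_one (by positivity)]; simp
    simp only [id]
    rw [e]
    ring
  have hode : ∀ u : ℝ, 2 * u * (derivative (derivative P)).eval (2 * u) +
      (ν - 2 * u) * (derivative P).eval (2 * u) + m * P.eval (2 * u) = 0 := fun u => by
    simpa using congrArg (eval (2 * u)) (ode (ν - 1) m)
  have hφ1 : ∀ u, HasDerivAt φ (deriv φ u) u := fun u =>
    (h.contDiff.differentiable (by simp) u).hasDerivAt
  have hφ2 : ∀ u, HasDerivAt (deriv φ) (deriv (deriv φ) u) u := fun u =>
    (h.deriv.contDiff.differentiable (by simp) u).hasDerivAt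
  let G : ℝ → ℂ := fun u => (q u : ℂ) * (φ u * (g u : ℂ) - deriv φ u * (f u : ℂ))
  have hG : ∀ u, 0 < u → HasDerivAt G (transposedOp ν φ u * (weighted ν m u : ℂ) -
      (2 * m + ν) * (φ u * (weighted ν m u : ℂ))) u := fun u hu => by
    refine ((hq u hu).ofReal_comp.mul (((hφ1 u).mul (hg u).ofReal_comp).sub
      ((hφ2 u).mul (hf u).ofReal_comp))).congr_deriv ?_
    have e := congrArg (fun x : ℝ => (x : ℂ)) (hode u)
    push_cast at e
    simp only [transposedOp, weighted, ← laguerrePoly.eval_eq, ← hP, f, g, q, Pi.sub_apply,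
      Pi.mul_apply]
    push_cast
    linear_combination 2 * Complex.exp (-u) * (((2 * u) ^ (ν - 1) : ℝ) : ℂ) * φ u * e
  have hint := (intervalIntegrable (ν := ν) (h.transposedOp (ν := ν)) m ha hab)
  have hint' := (intervalIntegrable (ν := ν) h m ha hab).const_mul (2 * m + ν : ℂ)
  have key := intervalIntegral.integral_eq_sub_of_hasDerivAt (a := a) (b := b) (f := G)
    (fun u hu => hG u (ha.trans_le (by rw [Set.uIcc_of_le hab] at hu; exact hu.1)))
    (hint.sub hint')
  have hGa : ∀ u ∉ Set.Ioo a b, G u = 0 := fun u hu => by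
    simp [G, h.eq_zero hu, h.deriv.eq_zero hu]
  rw [hGa a (by simp), hGa b (by simp), sub_zero, intervalIntegral.integral_sub hint hint',
    intervalIntegral.integral_const_mul, ← pairing_eq h.transposedOp m ha hab,
    ← pairing_eq h m ha hab] at key
  exact sub_eq_zero.1 key

lemma norm_pairing_le (hν : 0 < ν) (h : IsTest a b φ) (ha : 0 < a) (hab : a ≤ b) :
    ∃ C, ∀ m : ℕ, ‖pairing ν m φ‖ ≤ C * (laguerrePoly ν m).eval 0 := by
  obtain ⟨C, hC⟩ := isCompact_Icc.exists_bound_of_continuousOn (s := Set.Icc a b)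
    (f := fun u : ℝ => φ u * ((Real.exp u * (2 * u) ^ (ν - 1) : ℝ) : ℂ))
    (h.contDiff.continuous.continuousOn.mul (Complex.continuous_ofReal.comp_continuousOn
      (Real.continuous_exp.continuousOn.mul (continuousOn_rpow ν ha))))
  refine ⟨C * 2 * (b - a), fun m => ?_⟩
  have hpos := eval_zero_pos hν.le m
  rw [pairing_eq h m ha hab]
  refine (intervalIntegral.norm_integral_le_of_norm_le_const
    (C := C * (2 * (laguerrePoly ν m).eval 0)) fun u hu => ?_).trans_eq ?_
  · rw [Set.uIoc_of_le hab] at hu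
    have hu0 : 0 < u := ha.trans hu.1
    have hr : 0 ≤ (2 * u) ^ (ν - 1) := by positivity
    have hC' := hC u ⟨hu.1.le, hu.2⟩
    have hL := abs_eval_sub_one_le hν.le m (x := 2 * u) (by positivity)
    have e : Real.exp (-u) * Real.exp (2 * u) = Real.exp u := by
      rw [← Real.exp_add]; congr 1; ring
    rw [norm_mul, Complex.norm_real, Real.norm_eq_abs] at hC' ⊢
    have hw : |weighted ν m u| ≤ |Real.exp u * (2 * u) ^ (ν - 1)| *
        (2 * (laguerrePoly ν m).eval 0) := by
      rw [weighted, ← laguerrePoly.eval_eq, abs_mul, abs_mul, abs_mul, abs_of_nonneg hr,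
        Real.abs_exp, Real.abs_exp, ← e]
      calc _ ≤ Real.exp (-u) * (2 * Real.exp (2 * u) * (laguerrePoly ν m).eval 0) *
            (2 * u) ^ (ν - 1) := by gcongr
        _ = _ := by ring
    calc ‖φ u‖ * |weighted ν m u| ≤ ‖φ u‖ * (|Real.exp u * (2 * u) ^ (ν - 1)| *
          (2 * (laguerrePoly ν m).eval 0)) := by gcongr
      _ = ‖φ u‖ * |Real.exp u * (2 * u) ^ (ν - 1)| * (2 * (laguerrePoly ν m).eval 0) := by ring
      _ ≤ _ := by gcongr
  · rw [abs_of_nonneg (by linarith)]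
    ring

/-- The pairings decay faster than any power of `m`. -/
lemma exists_pow_mul_norm_pairing_le (hν : 0 < ν) (ha : 0 < a) (hab : a ≤ b) (p : ℕ)
    (h : IsTest a b φ) : ∃ C, ∀ m : ℕ, ((m : ℝ) + 1) ^ p * ‖pairing ν m φ‖ ≤ C := by
  obtain ⟨N, hN⟩ := exists_nat_ge ν
  have main : ∀ k : ℕ, ∀ φ, IsTest a b φ → ∃ C, ∀ m : ℕ,
      ((m : ℝ) + 1) ^ k * ‖pairing ν m φ‖ ≤ C * ((m : ℝ) + 1) ^ N := by
    intro k
    induction k with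
    | zero =>
      intro φ h
      obtain ⟨C, hC⟩ := norm_pairing_le hν h ha hab
      refine ⟨|C|, fun m => ?_⟩
      rw [pow_zero, one_mul]
      calc _ ≤ C * (laguerrePoly ν m).eval 0 := hC m
        _ ≤ |C| * (laguerrePoly ν m).eval 0 :=
          mul_le_mul_of_nonneg_right (le_abs_self C) (eval_zero_pos hν.le m).le
        _ ≤ _ := mul_le_mul_of_nonneg_left (eval_zero_le_pow hν.le hN m) (abs_nonneg C)
    | succ k ih =>
      intro φ h
      obtain ⟨C, hC⟩ := ih _ (h.transposedOp (ν := ν))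
      refine ⟨(1 + 1 / ν) * C, fun m => ?_⟩
      have e : ‖pairing ν m (transposedOp ν φ)‖ = (2 * m + ν) * ‖pairing ν m φ‖ := by
        rw [pairing_transposedOp h ha hab, norm_mul]
        congr 1
        have : (2 * m + ν : ℂ) = ((2 * m + ν : ℝ) : ℂ) := by push_cast; ring
        rw [this, Complex.norm_real, Real.norm_of_nonneg (by positivity)]
      have hm : (m : ℝ) + 1 ≤ (1 + 1 / ν) * (2 * m + ν) := by
        have e1 : (1 + 1 / ν) * (2 * m + ν) = 2 * m + ν + 2 * m / ν + 1 := by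
          field_simp
          ring
        have : 0 ≤ 2 * m / ν := by positivity
        have : (0 : ℝ) ≤ m := by positivity
        linarith
      have := hC m
      rw [e] at this
      calc _ = ((m : ℝ) + 1) ^ k * ((m : ℝ) + 1) * ‖pairing ν m φ‖ := by ring
        _ ≤ ((m : ℝ) + 1) ^ k * ((1 + 1 / ν) * (2 * m + ν)) * ‖pairing ν m φ‖ := by gcongr
        _ = (1 + 1 / ν) * (((m : ℝ) + 1) ^ k * ((2 * m + ν) * ‖pairing ν m φ‖)) := by ring
        _ ≤ (1 + 1 / ν) * (C * ((m : ℝ) + 1) ^ N) := by gcongr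
        _ = _ := by ring
  obtain ⟨C, hC⟩ := main (p + N) φ h
  refine ⟨C, fun m => ?_⟩
  refine le_of_mul_le_mul_right ?_ (by positivity : 0 < ((m : ℝ) + 1) ^ N)
  calc _ = ((m : ℝ) + 1) ^ (p + N) * ‖pairing ν m φ‖ := by ring
    _ ≤ _ := hC m

/-- The coefficient `(m! / (ν)_m) e^{-t} L_m^{ν-1}(2t)` of the distribution vector. -/
noncomputable def coefficient (ν t : ℝ) (m : ℕ) : ℝ :=
  (Nat.factorial m : ℝ) / (ascPochhammer ℝ m).eval ν *
    (Real.exp (-t) * laguerreL (ν - 1) m (2 * t))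

lemma abs_coefficient_le (hν : 0 < ν) {t : ℝ} (ht : 0 < t) :
    ∃ K, 0 ≤ K ∧ ∀ m : ℕ, |coefficient ν t m| ≤ K * ((m : ℝ) + 1) := by
  refine ⟨2 * Real.exp t * (1 + 1 / ν), by positivity, fun m => ?_⟩
  have hp := ascPochhammer_pos m ν hν
  have hL := abs_eval_sub_one_le hν.le m (x := 2 * t) (by positivity)
  have e : Real.exp (-t) * Real.exp (2 * t) = Real.exp t := by
    rw [← Real.exp_add]; congr 1; ring
  have e2 : (Nat.factorial m : ℝ) / (ascPochhammer ℝ m).eval ν * (laguerrePoly ν m).eval 0 =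
      1 + m / ν := by
    have := ascPochhammer_eval_succ_left ν m
    rw [ascPochhammer_succ_eval] at this
    rw [eval_zero_eq]
    field_simp
    linarith
  rw [coefficient, ← laguerrePoly.eval_eq, abs_mul, abs_mul, Real.abs_exp,
    abs_of_nonneg (by positivity)]
  calc _ ≤ (Nat.factorial m : ℝ) / (ascPochhammer ℝ m).eval ν *
        (Real.exp (-t) * (2 * Real.exp (2 * t) * (laguerrePoly ν m).eval 0)) := by gcongr
    _ = 2 * (Real.exp (-t) * Real.exp (2 * t)) * ((Nat.factorial m : ℝ) /
        (ascPochhammer ℝ m).eval ν * (laguerrePoly ν m).eval 0) := by ring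
    _ = 2 * Real.exp t * (1 + m / ν) := by rw [e, e2]
    _ ≤ 2 * Real.exp t * ((1 + 1 / ν) * ((m : ℝ) + 1)) := by
      gcongr
      have e1 : (1 + 1 / ν) * ((m : ℝ) + 1) = 1 + m / ν + m + 1 / ν := by ring
      have : 0 ≤ 1 / ν := by positivity
      have : (0 : ℝ) ≤ m := by positivity
      linarith
    _ = _ := by ring

lemma summable_norm (hν : 0 < ν) {t : ℝ} (ht : 0 < t) (h : IsTest a b φ) (ha : 0 < a)
    (hab : a ≤ b) : Summable fun m : ℕ => ‖(coefficient ν t m : ℂ) * pairing ν m φ‖ := by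
  obtain ⟨K, hK0, hK⟩ := abs_coefficient_le hν ht
  obtain ⟨C, hC⟩ := exists_pow_mul_norm_pairing_le hν ha hab 3 h
  have hs : Summable fun m : ℕ => K * C * (1 / ((m : ℝ) + 1) ^ 2) := by
    refine Summable.mul_left _ ?_
    simpa using (summable_nat_add_iff 1).2 (Real.summable_one_div_nat_pow.2 one_lt_two)
  refine Summable.of_nonneg_of_le (fun _ => norm_nonneg _) (fun m => ?_) hs
  rw [norm_mul, Complex.norm_real, Real.norm_eq_abs, mul_one_div, le_div_iff₀ (by positivity)]
  calc _ ≤ K * ((m : ℝ) + 1) * ‖pairing ν m φ‖ * ((m : ℝ) + 1) ^ 2 := by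
        gcongr
        exact hK m
    _ = K * (((m : ℝ) + 1) ^ 3 * ‖pairing ν m φ‖) := by ring
    _ ≤ K * C := by gcongr; exact hC m

lemma two_mul_coefficient_zero (hν : 0 < ν) (t : ℝ) :
    2 * t * coefficient ν t 0 = ν * (coefficient ν t 0 - coefficient ν t 1) := by
  simp only [coefficient, ← laguerrePoly.eval_eq, laguerrePoly.zero, laguerrePoly.one]
  simp
  field_simp
  ring

lemma two_mul_coefficient_succ (hν : 0 < ν) (t : ℝ) (n : ℕ) :
    2 * t * coefficient ν t (n + 1) = (2 * n + 2 + ν) * coefficient ν t (n + 1) -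
      (n + 1 + ν) * coefficient ν t (n + 2) - (n + 1) * coefficient ν t n := by
  have h := congrArg (eval (2 * t)) (three_term (ν - 1) n)
  simp only [eval_mul, eval_sub, eval_X, eval_C] at h
  simp only [coefficient, ← laguerrePoly.eval_eq]
  have hp := (ascPochhammer_pos n ν hν).ne'
  have h1 : ν + (n : ℝ) ≠ 0 := by positivity
  have h2 : ν + ((n : ℝ) + 1) ≠ 0 := by positivity
  rw [show n + 2 = n + 1 + 1 by ring, ascPochhammer_succ_eval (n + 1), ascPochhammer_succ_eval n,
    Nat.factorial_succ (n + 1), Nat.factorial_succ n]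
  push_cast
  field_simp
  linear_combination (ν + ((n : ℝ) + 1)) * h

/-- Christoffel–Darboux summation. -/
lemma sum_eq (hν : 0 < ν) (t : ℝ) (h : IsTest a b φ) (ha : 0 < a) (hab : a ≤ b) (M : ℕ) :
    ∑ m ∈ Finset.range (M + 1), 2 * ((coefficient ν t m : ℂ) *
      pairing ν m (fun u => u * φ u) - t * (coefficient ν t m * pairing ν m φ)) =
    (ν + M) * coefficient ν t (M + 1) * pairing ν M φ -
      (M + 1) * coefficient ν t M * pairing ν (M + 1) φ := by
  induction M with
  | zero =>
    have h1 := two_mul_pairing_zero (ν := ν) h ha hab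
    have h2 := congrArg (fun x : ℝ => (x : ℂ)) (two_mul_coefficient_zero hν t)
    push_cast at h2
    simp only [zero_add, Finset.range_one, Finset.sum_singleton]
    push_cast
    linear_combination coefficient ν t 0 * h1 - pairing ν 0 φ * h2
  | succ M ih =>
    have h1 := two_mul_pairing_succ (ν := ν) h ha hab M
    have h2 := congrArg (fun x : ℝ => (x : ℂ)) (two_mul_coefficient_succ hν t M)
    push_cast at h2
    rw [Finset.sum_range_succ, ih]
    push_cast
    linear_combination coefficient ν t (M + 1) * h1 - pairing ν (M + 1) φ * h2

open Filter Topology in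
lemma tsum_eq (hν : 0 < ν) {t : ℝ} (ht : 0 < t) (h : IsTest a b φ) (ha : 0 < a) (hab : a ≤ b) :
    ∑' m : ℕ, (coefficient ν t m : ℂ) * pairing ν m (fun u => u * φ u) =
      t * ∑' m : ℕ, (coefficient ν t m : ℂ) * pairing ν m φ := by
  have hs := (summable_norm hν ht h.id_mul ha hab).of_norm
  have hs' := (summable_norm hν ht h ha hab).of_norm
  have hsum := ((hs.hasSum.sub (hs'.hasSum.mul_left (t : ℂ))).mul_left 2).tendsto_sum_nat
  have hlim := hsum.comp (tendsto_add_atTop_nat 1)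
  obtain ⟨K, hK0, hK⟩ := abs_coefficient_le hν ht
  obtain ⟨C, hC⟩ := exists_pow_mul_norm_pairing_le hν ha hab 3 h
  have hzero : Tendsto (fun M : ℕ => (ν + M) * (coefficient ν t (M + 1) : ℂ) * pairing ν M φ -
      (M + 1) * coefficient ν t M * pairing ν (M + 1) φ) atTop (𝓝 0) := by
    have hB : Tendsto (fun M : ℕ => (2 * (ν + 1) * K * C + K * C) * (1 / ((M : ℝ) + 1)))
        atTop (𝓝 0) := by
      simpa using tendsto_one_div_add_atTop_nhds_zero_nat.const_mul (2 * (ν + 1) * K * C + K * C)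
    refine squeeze_zero_norm (fun M => ?_) hB
    have hM : (0 : ℝ) ≤ M := by positivity
    have hM1 := hK M
    have hM2 := hK (M + 1)
    have hC1 := hC M
    have hC2 := hC (M + 1)
    push_cast at hM2 hC2
    have n1 : ‖(ν + M : ℂ)‖ ≤ (ν + 1) * ((M : ℝ) + 1) := by
      have : (ν + M : ℂ) = ((ν + M : ℝ) : ℂ) := by push_cast; ring
      rw [this, Complex.norm_real, Real.norm_of_nonneg (by positivity)]
      nlinarith
    have n2 : ‖(M + 1 : ℂ)‖ = (M : ℝ) + 1 := by
      have : (M + 1 : ℂ) = ((M + 1 : ℝ) : ℂ) := by push_cast; ring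
      rw [this, Complex.norm_real, Real.norm_of_nonneg (by positivity)]
    refine (norm_sub_le _ _).trans ?_
    rw [norm_mul, norm_mul, norm_mul, norm_mul, Complex.norm_real, Complex.norm_real, n2,
      Real.norm_eq_abs, Real.norm_eq_abs, mul_one_div, le_div_iff₀ (by positivity), add_mul]
    refine add_le_add ?_ ?_
    · calc _ ≤ (ν + 1) * ((M : ℝ) + 1) * (K * (2 * ((M : ℝ) + 1))) * ‖pairing ν M φ‖ *
            ((M : ℝ) + 1) := by
            gcongr
            refine hM2.trans ?_
            gcongr
            linarith
        _ = 2 * (ν + 1) * K * (((M : ℝ) + 1) ^ 3 * ‖pairing ν M φ‖) := by ring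
        _ ≤ _ := by gcongr
    · calc _ ≤ ((M : ℝ) + 1) * (K * ((M : ℝ) + 1)) * ‖pairing ν (M + 1) φ‖ * ((M : ℝ) + 1) := by
            gcongr
        _ = K * (((M : ℝ) + 1) ^ 3 * ‖pairing ν (M + 1) φ‖) := by ring
        _ ≤ K * (((M : ℝ) + 1 + 1) ^ 3 * ‖pairing ν (M + 1) φ‖) := by
            gcongr
            linarith
        _ ≤ _ := by gcongr
  have := tendsto_nhds_unique hlim (hzero.congr fun M => (sum_eq hν t h ha hab M).symm)
  rw [mul_eq_zero, or_iff_right two_ne_zero, sub_eq_zero] at this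
  exact this

end laguerreFunction

/-- The Whittaker eigen-equation `x·W = t·W` for the distribution vector
`W = ∑_m (ℓ_m^ν(t)/(m!(ν)_m)) ℓ_m^ν`, tested against smooth functions compactly
supported in `(0,∞)` (rank-one case). -/
theorem whittaker_eigen_equation (ν t : ℝ) (hν : 0 < ν) (ht : 0 < t)
    (φ : ℝ → ℂ) (hφ : ContDiff ℝ (⊤ : ℕ∞) φ) (hcs : HasCompactSupport φ)
    (hsupp : tsupport φ ⊆ Set.Ioi 0) :
    (Summable fun m : ℕ =>
      ‖((Nat.factorial m : ℂ) / (((ascPochhammer ℝ m).eval ν : ℝ) : ℂ)) *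
        ((Real.exp (-t) * laguerreL (ν - 1) m (2 * t) : ℝ) : ℂ) *
        (((2 / Real.Gamma ν : ℝ) : ℂ) *
          ∫ u in Set.Ioi (0 : ℝ), (u : ℂ) * φ u *
            ((Real.exp (-u) * laguerreL (ν - 1) m (2 * u) * (2 * u) ^ (ν - 1) : ℝ) : ℂ))‖) ∧
    (Summable fun m : ℕ =>
      ‖((Nat.factorial m : ℂ) / (((ascPochhammer ℝ m).eval ν : ℝ) : ℂ)) *
        ((Real.exp (-t) * laguerreL (ν - 1) m (2 * t) : ℝ) : ℂ) *
        (((2 / Real.Gamma ν : ℝ) : ℂ) *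
          ∫ u in Set.Ioi (0 : ℝ), φ u *
            ((Real.exp (-u) * laguerreL (ν - 1) m (2 * u) * (2 * u) ^ (ν - 1) : ℝ) : ℂ))‖) ∧
    (∑' m : ℕ,
      ((Nat.factorial m : ℂ) / (((ascPochhammer ℝ m).eval ν : ℝ) : ℂ)) *
        ((Real.exp (-t) * laguerreL (ν - 1) m (2 * t) : ℝ) : ℂ) *
        (((2 / Real.Gamma ν : ℝ) : ℂ) *
          ∫ u in Set.Ioi (0 : ℝ), (u : ℂ) * φ u *
            ((Real.exp (-u) * laguerreL (ν - 1) m (2 * u) * (2 * u) ^ (ν - 1) : ℝ) : ℂ))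
      = (t : ℂ) * ∑' m : ℕ,
        ((Nat.factorial m : ℂ) / (((ascPochhammer ℝ m).eval ν : ℝ) : ℂ)) *
          ((Real.exp (-t) * laguerreL (ν - 1) m (2 * t) : ℝ) : ℂ) *
          (((2 / Real.Gamma ν : ℝ) : ℂ) *
            ∫ u in Set.Ioi (0 : ℝ), φ u *
              ((Real.exp (-u) * laguerreL (ν - 1) m (2 * u) * (2 * u) ^ (ν - 1) : ℝ) : ℂ))) := by
  obtain ⟨a, b, ha, hab, h⟩ := laguerreFunction.exists_isTest hφ hcs hsupp
  have key : ∀ (ψ : ℝ → ℂ) (m : ℕ),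
      ((Nat.factorial m : ℂ) / (((ascPochhammer ℝ m).eval ν : ℝ) : ℂ)) *
        ((Real.exp (-t) * laguerreL (ν - 1) m (2 * t) : ℝ) : ℂ) *
        (((2 / Real.Gamma ν : ℝ) : ℂ) * ∫ u in Set.Ioi (0 : ℝ), ψ u *
          ((Real.exp (-u) * laguerreL (ν - 1) m (2 * u) * (2 * u) ^ (ν - 1) : ℝ) : ℂ)) =
      ((2 / Real.Gamma ν : ℝ) : ℂ) * ((laguerreFunction.coefficient ν t m : ℂ) *
        laguerreFunction.pairing ν m ψ) := fun ψ m => by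
    simp only [laguerreFunction.coefficient, laguerreFunction.pairing, laguerreFunction.weighted]
    push_cast
    ring
  simp only [key φ, key fun u => (u : ℂ) * φ u]
  refine ⟨?_, ?_, ?_⟩
  · simp only [norm_mul ((2 / Real.Gamma ν : ℝ) : ℂ)]
    exact (laguerreFunction.summable_norm hν ht h.id_mul ha hab).mul_left _
  · simp only [norm_mul ((2 / Real.Gamma ν : ℝ) : ℂ)]
    exact (laguerreFunction.summable_norm hν ht h ha hab).mul_left _
  · rw [tsum_mul_left, tsum_mul_left, laguerreFunction.tsum_eq hν ht h ha hab]
    ring
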